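/- Assume k ≥ 2, that d_i ≥ 2 for at least one i (so the structure is distinct from the Veronese and Segre factorization structures), that β_{ir} = 0 for all (i,r), and that β₀ ≠ 0 (so P is the nonzero constant β₀). Then (A_{ir}) is extremal if and only if for each i = 1,…,k there exist a real polynomial Υ_i of degree at most d_i + 2 and real numbers ν⁰_{ir}, ν¹_{ir} (r = 1,…,d_i) such that A_{ir}(x) = Υ_i(x) + ν⁰_{ir} + ν¹_{ir} x for all x ∈ I_{ir}. -/

import Mathlib

noncomputable section

/-- The `r`-th elementary symmetric function of the values of `x` over the finite set `s`. -/
def esymmOn {n : ℕ} (s : Finset (Fin n)) (x : Fin n → ℝ) (r : ℕ) : ℝ :=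
  ∑ t ∈ s.powersetCard r, ∏ i ∈ t, x i

/-- `σ_r(x₁,…,x_n)`, the `r`-th elementary symmetric polynomial of `x₁,…,x_n`. -/
def esymm {n : ℕ} (x : Fin n → ℝ) (r : ℕ) : ℝ :=
  esymmOn Finset.univ x r

/-- `σ_r(x̂_j)`, the `r`-th elementary symmetric polynomial of the `n - 1` numbers
`x_i`, `i ≠ j`. -/
def esymmHat {n : ℕ} (x : Fin n → ℝ) (j : Fin n) (r : ℕ) : ℝ :=
  esymmOn (Finset.univ.erase j) x r

/-- `Δ_j(x) = ∏_{i ≠ j} (x_j - x_i)` (an empty product being `1`). -/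
def Delta {n : ℕ} (x : Fin n → ℝ) (j : Fin n) : ℝ :=
  ∏ i ∈ Finset.univ.erase j, (x j - x i)

/-- `f_i(x) = ∑_{r=1}^{d_i} β_{ir} σ_r(x_{i·})`. -/
def fSV (k : ℕ) (d : Fin k → ℕ) (β : (i : Fin k) → Fin (d i) → ℝ)
    (x : (i : Fin k) → Fin (d i) → ℝ) (i : Fin k) : ℝ :=
  ∑ r : Fin (d i), β i r * esymm (x i) ((r : ℕ) + 1)

/-- `P(x) = β₀ + ∑_i ∑_{r=1}^{d_i} β_{ir} σ_r(x_{i·})`. -/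
def PSV (k : ℕ) (d : Fin k → ℕ) (β0 : ℝ) (β : (i : Fin k) → Fin (d i) → ℝ)
    (x : (i : Fin k) → Fin (d i) → ℝ) : ℝ :=
  β0 + ∑ i : Fin k, fSV k d β x i

/-- `∂P/∂x_{iq} = ∑_{r=1}^{d_i} β_{ir} σ_{r−1}(x̂_{iq})`. -/
def dPSV (k : ℕ) (d : Fin k → ℕ) (β : (i : Fin k) → Fin (d i) → ℝ)
    (x : (i : Fin k) → Fin (d i) → ℝ) (i : Fin k) (q : Fin (d i)) : ℝ :=
  ∑ r : Fin (d i), β i r * esymmHat (x i) q (r : ℕ)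

/-- The extremality equation of the separable Kähler geometry associated with the
product Segre–Veronese factorization structure: there are reals `α₀` and `α_{ir}` such
that for all `x ∈ Ω`,
`∑_i ∑_q [P² A_{iq}'' − 2(m+1) P (∂P/∂x_{iq}) A_{iq}' + (m+1)(m+2) (∂P/∂x_{iq})² A_{iq}] / Δ_{iq}
  = α₀ + ∑_i ∑_r α_{ir} σ_r(x_{i·})`. -/
def IsExtremalSV (k : ℕ) (d : Fin k → ℕ) (m : ℕ) (β0 : ℝ)
    (β : (i : Fin k) → Fin (d i) → ℝ)
    (I : (i : Fin k) → Fin (d i) → Set ℝ)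
    (A : (i : Fin k) → Fin (d i) → ℝ → ℝ) : Prop :=
  ∃ (α0 : ℝ) (α : (i : Fin k) → Fin (d i) → ℝ),
    ∀ x : (i : Fin k) → Fin (d i) → ℝ, (∀ i r, x i r ∈ I i r) →
      (∑ i : Fin k, ∑ q : Fin (d i),
        ((PSV k d β0 β x) ^ 2 * deriv (deriv (A i q)) (x i q)
          - 2 * ((m : ℝ) + 1) * PSV k d β0 β x * dPSV k d β x i q * deriv (A i q) (x i q)
          + ((m : ℝ) + 1) * ((m : ℝ) + 2) * (dPSV k d β x i q) ^ 2 * A i q (x i q))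
          / Delta (x i) q)
      = α0 + ∑ i : Fin k, ∑ r : Fin (d i), α i r * esymm (x i) ((r : ℕ) + 1)

open Polynomial in
/-- Newton's form of the interpolant, evaluated at the last node. -/
theorem eq_eval_interpolate_add_sum_div {ι : Type*} [DecidableEq ι] {s : Finset ι} {a : ι}
    (ha : a ∉ s) (v r : ι → ℝ) (hv : Set.InjOn v (insert a s : Finset ι)) :
    r a = (Lagrange.interpolate s v r).eval (v a) +
      (∑ i ∈ insert a s, r i / ∏ j ∈ (insert a s).erase i, (v i - v j)) *
        ∏ j ∈ s, (v a - v j) := by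
  set S := ∑ i ∈ insert a s, r i / ∏ j ∈ (insert a s).erase i, (v i - v j) with hS
  set Q := Lagrange.interpolate (insert a s) v r with hQ
  have hQdeg : Q.degree < (insert a s).card := Lagrange.degree_interpolate_lt r hv
  have hcard : (insert a s).card = s.card + 1 := Finset.card_insert_of_notMem ha
  have hQeval : ∀ i ∈ insert a s, Q.eval (v i) = r i := fun i hi =>
    Lagrange.eval_interpolate_at_node r hv hi
  have hQcoeff : Q.coeff s.card = S := by
    have h := Lagrange.coeff_eq_sum hv hQdeg
    rw [hcard, Nat.add_sub_cancel] at h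
    rw [h, hS]
    exact Finset.sum_congr rfl fun i hi => by rw [hQeval i hi]
  have hvs : Set.InjOn v s := hv.mono (by simp)
  have hinterp : Q - C S * Lagrange.nodal s v = Lagrange.interpolate s v r := by
    refine Lagrange.eq_interpolate_of_eval_eq r hvs ?_ fun i hi => ?_
    · refine (degree_lt_iff_coeff_zero _ _).2 fun n hn => ?_
      rcases hn.eq_or_lt with rfl | hn
      · have := Lagrange.nodal_monic (s := s) (v := v)
        rw [Monic, leadingCoeff, Lagrange.natDegree_nodal] at this
        rw [coeff_sub, coeff_C_mul, hQcoeff, this, mul_one, sub_self]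
      · rw [coeff_sub, coeff_C_mul,
          (degree_lt_iff_coeff_zero _ _).1 hQdeg n (by omega),
          coeff_eq_zero_of_natDegree_lt (by rwa [Lagrange.natDegree_nodal])]
        simp
    · rw [eval_sub, eval_mul, Lagrange.eval_nodal_at_node hi, mul_zero, sub_zero,
        hQeval i (Finset.mem_insert_of_mem hi)]
  rw [← hinterp, eval_sub, eval_mul, eval_C, Lagrange.eval_nodal,
    hQeval a (Finset.mem_insert_self a s)]
  ring

theorem esymmOn_congr {n : ℕ} {s : Finset (Fin n)} {x y : Fin n → ℝ} (h : ∀ i ∈ s, x i = y i)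
    (r : ℕ) : esymmOn s x r = esymmOn s y r :=
  Finset.sum_congr rfl fun _ ht => Finset.prod_congr rfl fun i hi =>
    h i ((Finset.mem_powersetCard.1 ht).1 hi)

theorem esymmOn_insert {n : ℕ} {s : Finset (Fin n)} {a : Fin n} (ha : a ∉ s) (x : Fin n → ℝ)
    (r : ℕ) : esymmOn (insert a s) x (r + 1) = esymmOn s x (r + 1) + x a * esymmOn s x r := by
  have hnot : ∀ t ∈ s.powersetCard r, a ∉ t := fun t ht hat =>
    ha ((Finset.mem_powersetCard.1 ht).1 hat)
  unfold esymmOn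
  rw [Finset.powersetCard_succ_insert ha, Finset.sum_union, Finset.sum_image, Finset.mul_sum]
  · congr 1
    exact Finset.sum_congr rfl fun t ht => Finset.prod_insert (hnot t ht)
  · intro t ht u hu htu
    rw [← Finset.erase_insert (hnot t ht), ← Finset.erase_insert (hnot u hu)]
    exact congrArg (fun w => Finset.erase w a) htu
  · refine Finset.disjoint_left.2 fun t ht ht' => ?_
    obtain ⟨u, -, rfl⟩ := Finset.mem_image.1 ht'
    exact ha ((Finset.mem_powersetCard.1 ht).1 (Finset.mem_insert_self a u))

theorem esymm_update {n : ℕ} (y : Fin n → ℝ) (a : Fin n) (t : ℝ) (r : ℕ) :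
    esymm (Function.update y a t) (r + 1) = esymmHat y a (r + 1) + t * esymmHat y a r := by
  have h : ∀ i ∈ Finset.univ.erase a, Function.update y a t i = y i := fun i hi =>
    Function.update_of_ne (Finset.ne_of_mem_erase hi) _ _
  unfold esymm esymmHat
  rw [← Finset.insert_erase (Finset.mem_univ a), esymmOn_insert (Finset.notMem_erase a _),
    Finset.erase_insert (Finset.notMem_erase a _), esymmOn_congr h, esymmOn_congr h,
    Function.update_self]

theorem injective_of_forall_mem_of_disjoint {n : ℕ} {I : Fin n → Set ℝ}
    (hdisj : ∀ r s : Fin n, r ≠ s → Disjoint (I r) (I s)) {x : Fin n → ℝ}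
    (hx : ∀ r, x r ∈ I r) : Function.Injective x := by
  intro r s hrs
  by_contra hne
  exact Set.disjoint_left.1 (hdisj r s hne) (hx r) (hrs ▸ hx s)

open Polynomial in
theorem eval_eq_of_sum_div_Delta_eq {n : ℕ} {I : Fin n → Set ℝ}
    (hdisj : ∀ r s : Fin n, r ≠ s → Disjoint (I r) (I s)) {B : Fin n → ℝ → ℝ} {c0 : ℝ}
    {c : Fin n → ℝ}
    (h : ∀ x : Fin n → ℝ, (∀ r, x r ∈ I r) →
      ∑ q, B q (x q) / Delta x q = c0 + ∑ r : Fin n, c r * esymm x ((r : ℕ) + 1))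
    (a : Fin n) {y : Fin n → ℝ} (hy : ∀ r, y r ∈ I r) :
    ∃ p : ℝ[X], p.natDegree ≤ n ∧ (∀ t ∈ I a, p.eval t = B a t) ∧
      ∀ q, q ≠ a → p.eval (y q) = B q (y q) := by
  set s : Finset (Fin n) := Finset.univ.erase a with hs
  have has : a ∉ s := Finset.notMem_erase a _
  have hins : insert a s = Finset.univ := Finset.insert_erase (Finset.mem_univ a)
  have hcard : s.card + 1 = n := by
    rw [← Finset.card_insert_of_notMem has, hins, Finset.card_univ, Fintype.card_fin]
  have hyinj : Set.InjOn y s := (injective_of_forall_mem_of_disjoint hdisj hy).injOn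
  have hdegL := Lagrange.degree_interpolate_lt (fun q => B q (y q)) hyinj
  refine ⟨Lagrange.interpolate s y (fun q => B q (y q)) + Lagrange.nodal s y *
    (C (∑ r : Fin n, c r * esymmHat y a r) * X +
      C (c0 + ∑ r : Fin n, c r * esymmHat y a ((r : ℕ) + 1))), ?_, fun t ht => ?_, fun q hq => ?_⟩
  · refine natDegree_add_le_of_degree_le
      (natDegree_le_of_degree_le (hdegL.le.trans ?_)) (natDegree_mul_le.trans ?_)
    · exact_mod_cast (by omega : s.card ≤ n)
    · rw [Lagrange.natDegree_nodal]
      have := natDegree_linear_le (a := ∑ r : Fin n, c r * esymmHat y a r)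
        (b := c0 + ∑ r : Fin n, c r * esymmHat y a ((r : ℕ) + 1))
      omega
  · set x := Function.update y a t with hx
    have hxa : x a = t := Function.update_self a t y
    have hxy : ∀ i ∈ s, x i = y i := fun i hi =>
      Function.update_of_ne (Finset.ne_of_mem_erase hi) _ _
    have hxI : ∀ r, x r ∈ I r := by
      intro r
      rcases eq_or_ne r a with rfl | hr
      · rwa [hxa]
      · rw [hx, Function.update_of_ne hr]
        exact hy r
    have hxinj := injective_of_forall_mem_of_disjoint hdisj hxI
    have key := eq_eval_interpolate_add_sum_div has x (fun q => B q (x q)) hxinj.injOn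
    have hinterp : Lagrange.interpolate s y (fun q => B q (y q)) =
        Lagrange.interpolate s x (fun q => B q (x q)) := by
      refine Lagrange.eq_interpolate_of_eval_eq _ hxinj.injOn hdegL fun i hi => ?_
      rw [hxy i hi, Lagrange.eval_interpolate_at_node _ hyinj hi]
    have hsum : c0 + ∑ r : Fin n, c r * esymm x ((r : ℕ) + 1) =
        (∑ r : Fin n, c r * esymmHat y a r) * t +
          (c0 + ∑ r : Fin n, c r * esymmHat y a ((r : ℕ) + 1)) := by
      simp only [hx, esymm_update, mul_add, Finset.sum_add_distrib, Finset.sum_mul]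
      have : ∀ r : Fin n, c r * (t * esymmHat y a r) = c r * esymmHat y a r * t := fun r => by ring
      simp only [this]
      ring
    have hprod : ∏ j ∈ s, (t - y j) = ∏ j ∈ s, (t - x j) :=
      Finset.prod_congr rfl fun j hj => by rw [hxy j hj]
    have hF := h x hxI
    unfold Delta at hF
    simp only [hins, hF, hsum, hxa] at key
    simp only [eval_add, eval_mul, eval_C, eval_X, Lagrange.eval_nodal]
    rw [hprod, hinterp, key]
    ring
  · have hqs : q ∈ s := Finset.mem_erase.2 ⟨hq, Finset.mem_univ q⟩
    rw [eval_add, eval_mul, Lagrange.eval_nodal_at_node hqs, zero_mul, add_zero,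
      Lagrange.eval_interpolate_at_node _ hyinj hqs]

open Polynomial in
theorem exists_polynomial_of_sum_div_Delta_eq {n : ℕ} {I : Fin n → Set ℝ}
    (hI : ∀ r, (I r).Infinite)
    (hdisj : ∀ r s : Fin n, r ≠ s → Disjoint (I r) (I s)) {B : Fin n → ℝ → ℝ} {c0 : ℝ}
    {c : Fin n → ℝ}
    (h : ∀ x : Fin n → ℝ, (∀ r, x r ∈ I r) →
      ∑ q, B q (x q) / Delta x q = c0 + ∑ r : Fin n, c r * esymm x ((r : ℕ) + 1)) :
    ∃ p : ℝ[X], p.natDegree ≤ n ∧ ∀ q, ∀ t ∈ I q, p.eval t = B q t := by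
  rcases Nat.eq_zero_or_pos n with rfl | hn
  · exact ⟨0, by simp, fun q => q.elim0⟩
  choose y hy using fun r => (hI r).nonempty
  let a : Fin n := ⟨0, hn⟩
  obtain ⟨p, hpdeg, hpa, -⟩ := eval_eq_of_sum_div_Delta_eq hdisj h a hy
  refine ⟨p, hpdeg, fun q t ht => ?_⟩
  rcases eq_or_ne q a with rfl | hq
  · exact hpa t ht
  have hz : ∀ r, Function.update y q t r ∈ I r := by
    intro r
    rcases eq_or_ne r q with rfl | hr
    · rwa [Function.update_self]
    · rw [Function.update_of_ne hr]
      exact hy r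
  obtain ⟨p', -, hpa', hpq'⟩ := eval_eq_of_sum_div_Delta_eq hdisj h a hz
  have hpp : p = p' := eq_of_infinite_eval_eq p p' ((hI a).mono fun u hu =>
    (hpa u hu).trans (hpa' u hu).symm)
  have := hpq' q hq
  rwa [Function.update_self, ← hpp] at this

theorem esymm_one {n : ℕ} (x : Fin n → ℝ) : esymm x 1 = ∑ i, x i := by
  unfold esymm esymmOn
  rw [Finset.powersetCard_one, Finset.sum_map]
  simp

open Polynomial in
theorem sum_eval_div_Delta {n : ℕ} (hn : 0 < n) {x : Fin n → ℝ} (hx : Function.Injective x)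
    {p : ℝ[X]} (hp : p.natDegree ≤ n) :
    ∑ q, p.eval (x q) / Delta x q = p.coeff (n - 1) + p.coeff n * esymm x 1 := by
  set N := Lagrange.nodal Finset.univ x with hN
  have hNdeg : N.natDegree = n := by simp [hN]
  have hNn : N.coeff n = 1 := by
    have : N.Monic := Lagrange.nodal_monic
    rwa [Monic, leadingCoeff, hNdeg] at this
  have hNpred : N.coeff (n - 1) = -esymm x 1 := by
    have := prod_X_sub_C_coeff_card_pred Finset.univ x (by simpa using hn)
    rw [Finset.card_univ, Fintype.card_fin] at this
    rw [hN, Lagrange.nodal_eq, this, esymm_one]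
  have hdeg : (p - C (p.coeff n) * N).degree < (Finset.univ : Finset (Fin n)).card := by
    rw [Finset.card_univ, Fintype.card_fin]
    refine (degree_lt_iff_coeff_zero _ _).2 fun j hj => ?_
    rcases hj.eq_or_lt with rfl | hj
    · rw [coeff_sub, coeff_C_mul, hNn, mul_one, sub_self]
    · rw [coeff_sub, coeff_C_mul, coeff_eq_zero_of_natDegree_lt (hp.trans_lt hj),
        coeff_eq_zero_of_natDegree_lt (hNdeg.trans_lt hj), mul_zero, sub_zero]
  have h := Lagrange.coeff_eq_sum hx.injOn hdeg
  rw [Finset.card_univ, Fintype.card_fin, coeff_sub, coeff_C_mul, hNpred] at h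
  rw [show p.coeff (n - 1) + p.coeff n * esymm x 1 =
    p.coeff (n - 1) - p.coeff n * -esymm x 1 by ring, h]
  refine Finset.sum_congr rfl fun q hq => ?_
  rw [eval_sub, eval_mul, Lagrange.eval_nodal_at_node hq, mul_zero, sub_zero]
  rfl

open Polynomial in
theorem exists_derivative_eq (p : ℝ[X]) :
    ∃ q : ℝ[X], derivative q = p ∧ q.natDegree ≤ p.natDegree + 1 := by
  refine ⟨∑ i ∈ Finset.range (p.natDegree + 1), C (p.coeff i / (i + 1)) * X ^ (i + 1), ?_, ?_⟩
  · conv_rhs => rw [p.as_sum_range_C_mul_X_pow]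
    rw [derivative_sum]
    refine Finset.sum_congr rfl fun i _ => ?_
    rw [derivative_C_mul_X_pow, Nat.add_sub_cancel]
    congr 2
    push_cast
    field_simp
  · refine natDegree_sum_le_of_forall_le _ _ fun i hi => (natDegree_C_mul_X_pow_le _ _).trans ?_
    have := Finset.mem_range.1 hi
    omega

open Polynomial in
theorem exists_eq_eval_add_affine_of_deriv_deriv_eq {u v : ℝ} {f : ℝ → ℝ} {p : ℝ[X]}
    (hf : ContDiffOn ℝ (⊤ : ℕ∞) f (Set.Ioo u v))
    (h : ∀ t ∈ Set.Ioo u v, deriv (deriv f) t = (derivative (derivative p)).eval t) :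
    ∃ a b : ℝ, ∀ t ∈ Set.Ioo u v, f t = p.eval t + a + b * t := by
  have hf1 : DifferentiableOn ℝ f (Set.Ioo u v) := hf.differentiableOn (by simp)
  have hf2 : DifferentiableOn ℝ (deriv f) (Set.Ioo u v) :=
    (hf.deriv_of_isOpen (m := 1) isOpen_Ioo (by norm_cast)).differentiableOn (by simp)
  obtain ⟨b, hb⟩ := isOpen_Ioo.exists_eq_add_of_deriv_eq isPreconnected_Ioo hf2
    (g := fun t => (derivative p).eval t) (derivative p).differentiable.differentiableOn
    (fun t ht => by rw [Polynomial.deriv, h t ht])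
  obtain ⟨a, ha⟩ := isOpen_Ioo.exists_eq_add_of_deriv_eq isPreconnected_Ioo hf1
    (g := fun t => (p + C b * X).eval t) (p + C b * X).differentiable.differentiableOn
    (fun t ht => by rw [Polynomial.deriv, hb ht]; simp)
  refine ⟨a, b, fun t ht => ?_⟩
  rw [ha ht]
  simp only [eval_add, eval_mul, eval_C, eval_X]
  ring

open Polynomial in
theorem deriv_deriv_eq_of_eqOn_eval_add_affine {U : Set ℝ} (hU : IsOpen U) {f : ℝ → ℝ} {p : ℝ[X]}
    {a b : ℝ} (h : ∀ t ∈ U, f t = p.eval t + a + b * t) {t : ℝ} (ht : t ∈ U) :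
    deriv (deriv f) t = (derivative (derivative p)).eval t := by
  have hfun : f =ᶠ[nhds t] fun s => (p + C a + C b * X).eval s := by
    filter_upwards [hU.mem_nhds ht] with s hs
    rw [h s hs]
    simp
  have hderiv : deriv (fun s => (p + C a + C b * X).eval s) =
      fun s => (derivative (p + C a + C b * X)).eval s := by
    funext s
    exact Polynomial.deriv _
  rw [hfun.deriv.deriv_eq, hderiv, Polynomial.deriv]
  simp

/-- A sum of functions of independent blocks of variables is constant only if every summand is. -/
theorem exists_forall_eq_of_sum_eq {k : ℕ} {X : Fin k → Type*} {Ω : (i : Fin k) → Set (X i)}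
    (hΩ : ∀ i, (Ω i).Nonempty) {G : (i : Fin k) → X i → ℝ} {a : ℝ}
    (h : ∀ x : (i : Fin k) → X i, (∀ i, x i ∈ Ω i) → ∑ i, G i (x i) = a) (i : Fin k) :
    ∃ b, ∀ y ∈ Ω i, G i y = b := by
  choose x0 hx0 using hΩ
  refine ⟨a - ∑ j ∈ Finset.univ.erase i, G j (x0 j), fun y hy => ?_⟩
  have hmem : ∀ j, Function.update x0 i y j ∈ Ω j := by
    intro j
    rcases eq_or_ne j i with rfl | hj
    · rwa [Function.update_self]
    · rw [Function.update_of_ne hj]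
      exact hx0 j
  have key := h _ hmem
  rw [← Finset.add_sum_erase _ _ (Finset.mem_univ i), Function.update_self] at key
  rw [← key, eq_sub_iff_add_eq]
  congr 1
  refine Finset.sum_congr rfl fun j hj => ?_
  rw [Function.update_of_ne (Finset.ne_of_mem_erase hj)]

theorem isExtremalSV_iff_of_forall_eq_zero {k : ℕ} {d : Fin k → ℕ} {m : ℕ} {β0 : ℝ}
    {β : (i : Fin k) → Fin (d i) → ℝ} (hβ : ∀ i r, β i r = 0)
    {I : (i : Fin k) → Fin (d i) → Set ℝ} {A : (i : Fin k) → Fin (d i) → ℝ → ℝ} :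
    IsExtremalSV k d m β0 β I A ↔
      ∃ (α0 : ℝ) (α : (i : Fin k) → Fin (d i) → ℝ),
        ∀ x : (i : Fin k) → Fin (d i) → ℝ, (∀ i r, x i r ∈ I i r) →
          β0 ^ 2 * ∑ i, ∑ q, deriv (deriv (A i q)) (x i q) / Delta (x i) q =
            α0 + ∑ i : Fin k, ∑ r : Fin (d i), α i r * esymm (x i) ((r : ℕ) + 1) := by
  have hP : ∀ x, PSV k d β0 β x = β0 := fun x => by simp [PSV, fSV, hβ]
  have hdP : ∀ x i q, dPSV k d β x i q = 0 := fun x i q => by simp [dPSV, hβ]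
  simp only [IsExtremalSV, hP, hdP, Finset.mul_sum, mul_div_assoc, mul_zero, zero_mul, sub_zero,
    ne_eq, OfNat.ofNat_ne_zero, not_false_eq_true, zero_pow, add_zero]

/-- `k ≥ 2`, some `d_i ≥ 2` (so the structure is distinct from the Veronese
and Segre factorization structures), all `β_{ir} = 0` and `β₀ ≠ 0` (so `P` is the nonzero
constant `β₀`). Then `(A_{ir})` is extremal iff for each `i` there are a polynomial `Υ_i`
of degree at most `d_i + 2` and reals `ν⁰_{ir}, ν¹_{ir}` with
`A_{ir}(x) = Υ_i(x) + ν⁰_{ir} + ν¹_{ir} x` on `I_{ir}`. -/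
theorem statement7 (k : ℕ) (hk : 2 ≤ k) (d : Fin k → ℕ) (hd : ∀ i, 1 ≤ d i)
    (hd2 : ∃ i, 2 ≤ d i)
    (m : ℕ) (hm : m = ∑ i, d i) (hm2 : 2 ≤ m)
    (β0 : ℝ) (hβ0 : β0 ≠ 0)
    (β : (i : Fin k) → Fin (d i) → ℝ) (hβ : ∀ i r, β i r = 0)
    (I : (i : Fin k) → Fin (d i) → Set ℝ)
    (hI : ∀ i r, ∃ u v : ℝ, u < v ∧ I i r = Set.Ioo u v)
    (hdisj : ∀ i, ∀ r s : Fin (d i), r ≠ s → Disjoint (I i r) (I i s))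
    (A : (i : Fin k) → Fin (d i) → ℝ → ℝ)
    (hA : ∀ i r, ContDiffOn ℝ (⊤ : ℕ∞) (A i r) (I i r))
    (hP : ∀ x : (i : Fin k) → Fin (d i) → ℝ, (∀ i r, x i r ∈ I i r) →
      PSV k d β0 β x ≠ 0) :
    IsExtremalSV k d m β0 β I A ↔
      ∀ i : Fin k, ∃ Υ : Polynomial ℝ, Υ.natDegree ≤ d i + 2 ∧
        ∃ ν0 ν1 : Fin (d i) → ℝ,
          ∀ r : Fin (d i), ∀ x ∈ I i r,
            A i r x = Υ.eval x + ν0 r + ν1 r * x := by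
  rw [isExtremalSV_iff_of_forall_eq_zero hβ]
  have hopen : ∀ i r, IsOpen (I i r) := fun i r => by
    obtain ⟨u, v, -, h⟩ := hI i r
    exact h ▸ isOpen_Ioo
  have hinf : ∀ i r, (I i r).Infinite := fun i r => by
    obtain ⟨u, v, huv, h⟩ := hI i r
    exact h ▸ Set.Ioo_infinite huv
  have hβ2 : β0 ^ 2 ≠ 0 := pow_ne_zero 2 hβ0
  constructor
  · rintro ⟨α0, α, h⟩ i
    obtain ⟨b, hb⟩ := exists_forall_eq_of_sum_eq
      (Ω := fun i => {y : Fin (d i) → ℝ | ∀ r, y r ∈ I i r})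
      (fun i => ⟨fun r => (hinf i r).nonempty.some, fun r => (hinf i r).nonempty.some_mem⟩)
      (G := fun i y => β0 ^ 2 * ∑ q, deriv (deriv (A i q)) (y q) / Delta y q -
        ∑ r : Fin (d i), α i r * esymm y ((r : ℕ) + 1)) (a := α0)
      (fun x hx => by rw [Finset.sum_sub_distrib, ← Finset.mul_sum, h x hx]; ring) i
    obtain ⟨p, hpdeg, hp⟩ := exists_polynomial_of_sum_div_Delta_eq (hinf i) (hdisj i)
      (B := fun q => deriv (deriv (A i q))) (c0 := b / β0 ^ 2) (c := fun r => α i r / β0 ^ 2)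
      (fun y hy => by
        have key := hb y hy
        simp only [div_mul_eq_mul_div, ← Finset.sum_div]
        rw [← add_div, eq_div_iff hβ2, ← key]
        ring)
    obtain ⟨p1, rfl, hp1⟩ := exists_derivative_eq p
    obtain ⟨p2, rfl, hp2⟩ := exists_derivative_eq p1
    have haff : ∀ r, ∃ a b : ℝ, ∀ t ∈ I i r, A i r t = p2.eval t + a + b * t := by
      intro r
      obtain ⟨u, v, -, huv⟩ := hI i r
      have hAr := hA i r
      have hpr := hp r
      rw [huv] at hAr hpr ⊢
      exact exists_eq_eval_add_affine_of_deriv_deriv_eq hAr fun t ht => (hpr t ht).symm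
    choose ν0 ν1 hν using haff
    exact ⟨p2, by omega, ν0, ν1, hν⟩
  · intro h
    choose Υ hΥ ν0 ν1 hν using h
    let p := fun i => Polynomial.derivative (Polynomial.derivative (Υ i))
    have hpdeg : ∀ i, (p i).natDegree ≤ d i := fun i => by
      have h1 := Polynomial.natDegree_derivative_le (Υ i)
      have h2 := Polynomial.natDegree_derivative_le (Polynomial.derivative (Υ i))
      have h3 := hΥ i
      change (Polynomial.derivative (Polynomial.derivative (Υ i))).natDegree ≤ d i
      omega
    refine ⟨β0 ^ 2 * ∑ i, (p i).coeff (d i - 1),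
      fun i r => if r = ⟨0, hd i⟩ then β0 ^ 2 * (p i).coeff (d i) else 0, fun x hx => ?_⟩
    have hsum : ∀ i, ∑ q, deriv (deriv (A i q)) (x i q) / Delta (x i) q =
        (p i).coeff (d i - 1) + (p i).coeff (d i) * esymm (x i) 1 := by
      intro i
      rw [← sum_eval_div_Delta (hd i) (injective_of_forall_mem_of_disjoint (hdisj i) (hx i))
        (hpdeg i)]
      refine Finset.sum_congr rfl fun q _ => ?_
      rw [deriv_deriv_eq_of_eqOn_eval_add_affine (hopen i q) (hν i q) (hx i q)]
    simp only [hsum, ite_mul, zero_mul, Finset.sum_ite_eq', Finset.mem_univ, if_true,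
      Finset.sum_add_distrib, mul_add, zero_add, Finset.mul_sum, mul_assoc]

end
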